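/- arXiv:0809.3227 — 3 statements merged into one kernel-verified Lean document; each statement's English description precedes it below -/
import Mathlib

section
/- Let H be a separable Hilbert space and let x ∈ B(H) be a proper isometry, i.e. x*x = 1 and xx* ≠ 1. Then there exists a unitary u ∈ B(H) such that (ux)ⁿ((ux)*)ⁿ → 0 strongly, i.e. ‖(ux)ⁿ((ux)*)ⁿ ξ‖ → 0 as n → ∞ for every ξ ∈ H. -/
open ContinuousLinearMap Filter Topology

/-- An orthonormal family in a separable inner product space is countable. -/
theorem Orthonormal.countable_of_separableSpace {𝕜 E ι : Type*} [RCLike 𝕜]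
    [NormedAddCommGroup E] [InnerProductSpace 𝕜 E] [TopologicalSpace.SeparableSpace E]
    {v : ι → E} (hv : Orthonormal 𝕜 v) : Countable ι := by
  refine Pairwise.countable_of_isOpen_disjoint (s := fun i => Metric.ball (v i) (1 / 2)) ?_
    (fun i => Metric.isOpen_ball) (fun i => ⟨v i, Metric.mem_ball_self (by norm_num)⟩)
  intro i j hij
  apply Metric.ball_disjoint_ball
  have h := @norm_sub_sq 𝕜 E _ _ _ (v i) (v j)
  rw [hv.2 hij, hv.1 i, hv.1 j] at h
  norm_num at h
  rw [dist_eq_norm]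
  nlinarith [norm_nonneg (v i - v j)]

section

variable {H : Type*} [NormedAddCommGroup H] [InnerProductSpace ℂ H] [CompleteSpace H]

/-- An isometry extends an orthonormal basis of `ker x*` together with the image of a Hilbert basis
of the whole space to a new Hilbert basis, with matching indices. -/
theorem exists_hilbertBasis_ker_adjoint_image {ι : Type*} {x : H →L[ℂ] H} (hx : star x * x = 1)
    (k : HilbertBasis ι ℂ (star x : H →L[ℂ] H).ker) (b : HilbertBasis (ι × ℕ) ℂ H) :
    ∃ c : HilbertBasis (ι × ℕ) ℂ H, ∀ i n, c (i, n + 1) = x (b (i, n)) := by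
  have hxx (ξ : H) : star x (x ξ) = ξ := DFunLike.congr_fun hx ξ
  have hinner (ξ η : H) : inner ℂ (x ξ) η = inner ℂ ξ (star x η) :=
    (adjoint_inner_right x ξ η).symm
  have hker (i : ι) : star x (k i : H) = 0 := (k i).2
  let f : ι × ℕ → H := fun p => Nat.casesOn p.2 (k p.1 : H) fun n => x (b (p.1, n))
  have hf_zero (i : ι) : f (i, 0) = k i := rfl
  have hf_succ (i : ι) (n : ℕ) : f (i, n + 1) = x (b (i, n)) := rfl
  have hf : Orthonormal ℂ f := by
    classical
    have hb := orthonormal_iff_ite.1 b.orthonormal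
    have hk := orthonormal_iff_ite.1 k.orthonormal
    rw [orthonormal_iff_ite]
    rintro ⟨i, _ | m⟩ ⟨j, _ | n⟩
    · simpa [hf_zero] using hk i j
    · rw [hf_zero, hf_succ, ← inner_conj_symm, hinner, hker]
      simp
    · rw [hf_zero, hf_succ, hinner, hker]
      simp
    · rw [hf_succ, hf_succ, hinner, hxx, hb]
      simp
  have hsp : (Submodule.span ℂ (Set.range f))ᗮ = ⊥ := by
    rw [eq_bot_iff]
    intro ξ hξ
    have hperp (p : ι × ℕ) : inner ℂ (f p) ξ = 0 :=
      (Submodule.mem_orthogonal _ _).1 hξ _ (Submodule.subset_span ⟨p, rfl⟩)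
    have hξk : star x ξ = 0 := by
      refine b.repr.injective ?_
      ext ⟨i, n⟩
      rw [b.repr_apply_apply, ← hinner]
      simpa [hf_succ] using hperp (i, n + 1)
    have : (⟨ξ, hξk⟩ : (star x : H →L[ℂ] H).ker) = 0 := by
      refine k.repr.injective ?_
      ext i
      rw [k.repr_apply_apply]
      simpa [hf_zero] using hperp (i, 0)
    exact congrArg Subtype.val this
  exact ⟨HilbertBasis.mkOfOrthogonalEqBot hf hsp, fun i n => by simp [hf_succ]⟩

/-- Any two Hilbert bases with the same index type are related by a unitary. -/
theorem HilbertBasis.exists_unitary_map {ι : Type*} (c b : HilbertBasis ι ℂ H) :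
    ∃ u : H →L[ℂ] H, star u * u = 1 ∧ u * star u = 1 ∧ ∀ i, u (c i) = b i := by
  let e : H ≃ₗᵢ[ℂ] H := c.repr.trans b.repr.symm
  have hadj : star (e : H →L[ℂ] H) = (e.symm : H →L[ℂ] H) :=
    LinearIsometryEquiv.adjoint_eq_symm e
  refine ⟨(e : H →L[ℂ] H), ?_, ?_, fun i => ?_⟩
  · rw [hadj]; ext ξ; simp
  · rw [hadj]; ext ξ; simp
  · classical
    change b.repr.symm (c.repr (c i)) = b i
    rw [c.repr_self, b.repr_symm_single]

/-- An isometry acting as a shift along a Hilbert basis indexed by `ι × ℕ` is pure. -/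
theorem tendsto_pow_mul_star_pow_of_shift {ι : Type*} {v : H →L[ℂ] H} (hv : star v * v = 1)
    (b : HilbertBasis (ι × ℕ) ℂ H) (hb : ∀ i n, v (b (i, n)) = b (i, n + 1)) (ξ : H) :
    Tendsto (fun n : ℕ => (v ^ n * star (v ^ n)) ξ) atTop (𝓝 0) := by
  have hvv (ξ : H) : star v (v ξ) = ξ := DFunLike.congr_fun hv ξ
  have hpow (n : ℕ) : star (v ^ n) * v ^ n = 1 := by
    induction n with
    | zero => simp
    | succ n ih =>
      rw [pow_succ, star_mul, mul_assoc, ← mul_assoc (star (v ^ n)), ih, one_mul, hv]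
  have hstar0 (i : ι) : star v (b (i, 0)) = 0 := by
    classical
    refine b.repr.injective ?_
    ext ⟨j, n⟩
    rw [b.repr_apply_apply]
    have : inner ℂ (b (j, n)) (star v (b (i, 0))) = inner ℂ (v (b (j, n))) (b (i, 0)) :=
      adjoint_inner_right v _ _
    rw [this, hb, orthonormal_iff_ite.1 b.orthonormal]
    simp
  have hkill (i : ι) (m n : ℕ) (hmn : m < n) : (star v ^ n) (b (i, m)) = 0 := by
    induction n generalizing m with
    | zero => omega
    | succ n ih =>
      rw [pow_succ, mul_apply_eq_comp]
      cases m with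
      | zero => rw [hstar0, map_zero]
      | succ m => rw [← hb, hvv, ih m (by omega)]
  have hnorm (n : ℕ) (η : H) : ‖(v ^ n * star (v ^ n)) η‖ ≤ ‖η‖ := by
    have h1 : ‖(v ^ n * star (v ^ n))‖ ≤ 1 := by
      have : IsStarProjection (v ^ n * star (v ^ n)) :=
        ⟨by rw [IsIdempotentElem, mul_assoc, ← mul_assoc (star (v ^ n)), hpow, one_mul],
          IsSelfAdjoint.mul_star_self _⟩
      exact this.norm_le
    simpa using le_of_opNorm_le _ h1 η
  have hev (η : H) (hη : η ∈ Submodule.span ℂ (Set.range b)) :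
      ∀ᶠ n : ℕ in atTop, (v ^ n * star (v ^ n)) η = 0 := by
    induction hη using Submodule.span_induction with
    | mem y hy =>
      obtain ⟨⟨i, m⟩, rfl⟩ := hy
      filter_upwards [eventually_gt_atTop m] with n hn
      rw [mul_apply_eq_comp, star_pow, hkill i m n hn, map_zero]
    | zero => simp
    | add y z _ _ hy hz =>
      filter_upwards [hy, hz] with n h1 h2
      rw [map_add, h1, h2, add_zero]
    | smul a y _ hy =>
      filter_upwards [hy] with n h1
      rw [map_smul, h1, smul_zero]
  rw [Metric.tendsto_nhds]
  intro ε hε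
  have hmem : ξ ∈ closure (Submodule.span ℂ (Set.range b) : Set H) := by
    rw [← Submodule.topologicalClosure_coe, b.dense_span]; trivial
  obtain ⟨η, hη, hd⟩ := Metric.mem_closure_iff.1 hmem ε hε
  filter_upwards [hev η hη] with n hn
  have := hnorm n (ξ - η)
  rw [map_sub, hn, sub_zero] at this
  rw [dist_zero_right]
  rw [dist_eq_norm] at hd
  exact this.trans_lt hd

/-- A proper isometry lives on an infinite-dimensional space. -/
theorem not_finiteDimensional_of_proper_isometry {x : H →L[ℂ] H} (hx : star x * x = 1)
    (hproper : x * star x ≠ 1) : ¬ FiniteDimensional ℂ H := by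
  intro _
  have h : (star x : H →L[ℂ] H).toLinearMap * x.toLinearMap = 1 :=
    congrArg ContinuousLinearMap.toLinearMap hx
  rw [mul_eq_one_comm] at h
  exact hproper (ContinuousLinearMap.coe_injective h)

end


/-- Lemma 5.2: if `x` is a proper isometry on a separable Hilbert space `H`, then there is
a unitary `u ∈ B(H)` such that `(ux)ⁿ((ux)*)ⁿ → 0` strongly. -/
theorem stmt_8 {H : Type*} [NormedAddCommGroup H] [InnerProductSpace ℂ H] [CompleteSpace H]
    [TopologicalSpace.SeparableSpace H]
    (x : H →L[ℂ] H) (hiso : star x * x = 1) (hproper : x * star x ≠ 1) :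
    ∃ u : H →L[ℂ] H, star u * u = 1 ∧ u * star u = 1 ∧
      ∀ ξ : H, Filter.Tendsto (fun n : ℕ => ((u * x) ^ n * star ((u * x) ^ n)) ξ)
        Filter.atTop (nhds 0) := by
  obtain ⟨s, k, -⟩ := exists_hilbertBasis ℂ (star x : H →L[ℂ] H).ker
  obtain ⟨w, b₀, -⟩ := exists_hilbertBasis ℂ H
  have : Countable s := k.orthonormal.countable_of_separableSpace
  have : Countable w := b₀.orthonormal.countable_of_separableSpace
  have : Nonempty s := by
    by_contra hs
    rw [not_nonempty_iff] at hs
    refine hproper (ContinuousLinearMap.ext fun ξ => ?_)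
    have hmem : star x (ξ - x (star x ξ)) = 0 := by
      rw [map_sub, sub_eq_zero]
      exact (DFunLike.congr_fun hiso (star x ξ)).symm
    have hzero : (⟨ξ - x (star x ξ), hmem⟩ : (star x : H →L[ℂ] H).ker) = 0 := by
      refine k.repr.injective ?_
      ext i
      exact isEmptyElim i
    exact (sub_eq_zero.1 (congrArg Subtype.val hzero)).symm
  have : Infinite w := by
    by_contra hw
    rw [not_infinite_iff_finite] at hw
    have := Fintype.ofFinite w
    exact not_finiteDimensional_of_proper_isometry hiso hproper
      b₀.toOrthonormalBasis.toBasis.finiteDimensional_of_finite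
  obtain ⟨e⟩ : Nonempty (w ≃ s × ℕ) := nonempty_equiv_of_countable
  let b : HilbertBasis (s × ℕ) ℂ H :=
    HilbertBasis.mk (b₀.orthonormal.comp e.symm e.symm.injective) <| by
      rw [e.symm.surjective.range_comp, b₀.dense_span]
  obtain ⟨c, hc⟩ := exists_hilbertBasis_ker_adjoint_image hiso k b
  obtain ⟨u, hu, hu', huc⟩ := c.exists_unitary_map b
  refine ⟨u, hu, hu', tendsto_pow_mul_star_pow_of_shift ?_ b fun i n => ?_⟩
  · rw [star_mul, mul_assoc, ← mul_assoc (star u), hu, one_mul, hiso]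
  · rw [mul_apply_eq_comp, ← hc, huc]
end

section
/- Let A be a finite unital C*-algebra, i.e. every x ∈ A with x*x = 1 satisfies xx* = 1. Then for every x ∈ A with ‖x‖ ≤ 1, one has ‖1 − xx*‖ = ‖1 − x*x‖. -/
/-- In a finite unital C⋆-algebra, an element `x` with `x*x` invertible is invertible: the isometric
part of its polar decomposition is a unitary. -/
theorem isUnit_of_isUnit_star_mul_self {A : Type*} [CStarAlgebra A]
    (hfin : ∀ x : A, star x * x = 1 → x * star x = 1) {x : A} (hx : IsUnit (star x * x)) :
    IsUnit x := by
  let _ : PartialOrder A := CStarAlgebra.spectralOrder A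
  have : StarOrderedRing A := CStarAlgebra.spectralOrderedRing A
  have hs : CFC.sqrt (star x * x) * CFC.sqrt (star x * x) = star x * x :=
    CFC.sqrt_mul_sqrt_self _ (star_mul_self_nonneg x)
  have hsa : star (CFC.sqrt (star x * x)) = CFC.sqrt (star x * x) :=
    (IsSelfAdjoint.of_nonneg (CFC.sqrt_nonneg _)).star_eq
  obtain ⟨u, hu⟩ : IsUnit (CFC.sqrt (star x * x)) :=
    ((Commute.refl _).isUnit_mul_iff.mp (hs.symm ▸ hx)).1
  rw [← hu] at hs hsa
  have hsi : star (↑u⁻¹ : A) = ↑u⁻¹ := by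
    have h : star u = u := Units.ext hsa
    rw [← Units.coe_star, star_inv, h]
  have hv : star (x * ↑u⁻¹) * (x * ↑u⁻¹) = 1 := by
    calc star (x * ↑u⁻¹) * (x * ↑u⁻¹) = ↑u⁻¹ * (star x * x) * ↑u⁻¹ := by
          rw [star_mul, hsi]; simp only [mul_assoc]
      _ = 1 := by rw [← hs]; simp
  have hw : IsUnit (x * ↑u⁻¹) := ⟨⟨_, _, hfin _ hv, hv⟩, rfl⟩
  simpa using hw

/-- In a finite unital C⋆-algebra, `xx*` and `x*x` have the same spectrum. -/
theorem spectrum_self_mul_star_eq {A : Type*} [CStarAlgebra A]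
    (hfin : ∀ x : A, star x * x = 1 → x * star x = 1) (x : A) :
    spectrum ℂ (x * star x) = spectrum ℂ (star x * x) := by
  have hunit : IsUnit (x * star x) ↔ IsUnit (star x * x) := by
    constructor <;> intro h
    · have h' : IsUnit (star x) := isUnit_of_isUnit_star_mul_self hfin (by simpa using h)
      exact h'.mul (isUnit_star.mp h')
    · have h' := isUnit_of_isUnit_star_mul_self hfin h
      exact h'.mul h'.star
  ext z
  by_cases hz : z = 0
  · rw [hz, spectrum.zero_mem_iff, spectrum.zero_mem_iff, hunit]
  · simpa [hz] using Set.ext_iff.mp (spectrum.nonzero_mul_comm (𝕜 := ℂ) x (star x)) z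

/-- Equation (3.7): in a finite unital C⋆-algebra `A` (every isometry is a unitary), every
contraction `x` satisfies `‖1 − xx*‖ = ‖1 − x*x‖`. -/
theorem stmt_10 {A : Type*} [CStarAlgebra A]
    (hfin : ∀ x : A, star x * x = 1 → x * star x = 1) :
    ∀ x : A, ‖x‖ ≤ 1 → ‖1 - x * star x‖ = ‖1 - star x * x‖ := by
  intro x _
  have hspec : spectrum ℂ (1 - x * star x) = spectrum ℂ (1 - star x * x) := by
    have h := spectrum_self_mul_star_eq hfin x
    rw [← map_one (algebraMap ℂ A), ← spectrum.singleton_sub_eq, ← spectrum.singleton_sub_eq, h]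
  have h₁ := ((IsSelfAdjoint.one A).sub (IsSelfAdjoint.mul_star_self x)).spectralRadius_eq_nnnorm
  have h₂ := ((IsSelfAdjoint.one A).sub (IsSelfAdjoint.star_mul_self x)).spectralRadius_eq_nnnorm
  rw [spectralRadius, hspec, ← spectralRadius, h₂, ENNReal.coe_inj] at h₁
  exact congrArg NNReal.toReal h₁.symm
end

section
/- Let A be a unital C*-algebra and y ∈ A with ‖1 − y*y‖ < 1/4 and ‖1 − yy*‖ > 3/4. Then y*y is invertible in A, and the element z = y·(y*y)^{−1/2} (defined via continuous functional calculus on the positive invertible element y*y) is a proper isometry: z*z = 1 and zz* ≠ 1. -/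
/-- From the proof of Theorem 5.4: if `y` is an element of a unital C⋆-algebra with
`‖1 − y*y‖ < 1/4` and `‖1 − yy*‖ > 3/4`, then `y*y` is invertible and
`z = y·(y*y)^{−1/2}` (continuous functional calculus) is a proper isometry. -/
theorem stmt_11 {A : Type*} [CStarAlgebra A]
    (y : A) (h1 : ‖1 - star y * y‖ < 1 / 4) (h2 : 3 / 4 < ‖1 - y * star y‖) :
    IsUnit (star y * y) ∧
    star (y * cfc (fun t : ℝ => t ^ (-(1 / 2) : ℝ)) (star y * y)) *
        (y * cfc (fun t : ℝ => t ^ (-(1 / 2) : ℝ)) (star y * y)) = 1 ∧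
    (y * cfc (fun t : ℝ => t ^ (-(1 / 2) : ℝ)) (star y * y)) *
        star (y * cfc (fun t : ℝ => t ^ (-(1 / 2) : ℝ)) (star y * y)) ≠ 1 := by
  set b := star y * y with hb
  set h := cfc (fun t : ℝ => t ^ (-(1 / 2) : ℝ)) b with hh
  have hu : IsUnit b := by
    simpa using isUnit_one_sub_of_norm_lt_one (h1.trans (by norm_num : (1 / 4 : ℝ) < 1))
  have hsa : IsSelfAdjoint b := IsSelfAdjoint.star_mul_self y
  have hpos : ∀ t ∈ spectrum ℝ b, 0 < t := fun t ht =>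
    (spectrum_star_mul_self_nonneg t ht).lt_of_ne fun h0 =>
      (spectrum.zero_notMem_iff ℝ).2 hu (h0 ▸ ht)
  have hcont : ContinuousOn (fun t : ℝ => t ^ (-(1 / 2) : ℝ)) (spectrum ℝ b) := fun t ht =>
    (Real.continuousAt_rpow_const t _ (Or.inl (hpos t ht).ne')).continuousWithinAt
  have hsh : star h = h := (cfc_predicate (R := ℝ) (p := IsSelfAdjoint) _ b).star_eq
  have hbh : h * b * h = 1 := by
    have hid : h * b * h = h * cfc (fun t : ℝ => t) b * h := by rw [cfc_id' ℝ b hsa]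
    rw [hid, hh, ← cfc_mul _ _ b hcont (continuousOn_id' _),
      ← cfc_mul (fun t : ℝ => t ^ (-(1 / 2) : ℝ) * t) _ b (hcont.mul (continuousOn_id' _)) hcont,
      ← cfc_const_one ℝ b]
    refine cfc_congr fun t ht => ?_
    have ht0 := hpos t ht
    calc t ^ (-(1 / 2) : ℝ) * t * t ^ (-(1 / 2) : ℝ)
        = t ^ (-(1 / 2) : ℝ) * t ^ (1 : ℝ) * t ^ (-(1 / 2) : ℝ) := by rw [Real.rpow_one]
      _ = 1 := by
        rw [← Real.rpow_add ht0, ← Real.rpow_add ht0]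
        norm_num
  have hz : star (y * h) * (y * h) = 1 := by
    rw [star_mul, hsh, ← hbh, hb]
    simp only [mul_assoc]
  refine ⟨hu, hz, fun hz' => ?_⟩
  have hmem : y * h ∈ unitary A := Unitary.mem_iff.2 ⟨hz, hz'⟩
  have hconj : y * h * b * star (y * h) = y * star y := by
    calc y * h * b * star (y * h) = y * (h * b * h) * star y := by
          rw [star_mul, hsh]
          simp only [mul_assoc]
      _ = y * star y := by rw [hbh, mul_one]
  have hnorm : ‖1 - y * star y‖ = ‖1 - b‖ := by
    have : 1 - y * star y = y * h * (1 - b) * star (y * h) := by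
      rw [mul_sub, sub_mul, mul_one, hz', hconj]
    rw [this, CStarRing.norm_mul_mem_unitary _ (Unitary.star_mem hmem),
      CStarRing.norm_mem_unitary_mul _ hmem]
  linarith
end
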